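/- arXiv:2210.08832 — 9 statements merged into one kernel-verified Lean document; each statement's English description precedes it below -/
import Mathlib

section
/- High SNR approximation: as σ² → 0 (with η, κ, ρ fixed), the quantities V₋ and V₊ satisfy: (i) if κ < 1 and η > 1, then V₋ = −ρ·log((1−κ)(1−η^{−1})) + 1 + O(σ²) and V₊ = −ρ·log((1−κ)(1−η^{−1})) + 1 + O(σ²); (ii) if η < 1 and ηκ < 1, then V₋ = −ρ·log((1−η)(1−ηκ)) + η + O(σ²) and V₊ = −ρ·log((1−η)(1−ηκ)) + η(2−η) + O(σ²); (iii) if (κ > 1 and η > 1) or (ηκ > 1 and η < 1), then V₋ = −ρ·log((1−κ^{−1})(1−(ηκ)^{−1})) + 1/κ + O(σ²) and V₊ = −ρ·log((1−κ^{−1})(1−(ηκ)^{−1})) + 1/κ + (κ−1)/κ² + O(σ²). -/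
open Asymptotics Filter
open scoped Topology

/-- The cubic equation determining the fundamental parameter ω of the
Rayleigh-product channel, with parameters η, κ and noise power t = σ². -/
def cubicEq (η κ t ω : ℝ) : Prop :=
  ω ^ 3 + (2 * t + η * κ - κ - η + 1) * ω ^ 2 / t
    + (1 + η * κ / t - 2 * η / t + 1 / t) * ω - η / t = 0

/-- The selected root of the cubic at parameters η, κ, t: the real root ω with
ω > 0 and η + (η−1)ω > 0. -/
def IsSelRoot (η κ t ω : ℝ) : Prop :=
  cubicEq η κ t ω ∧ 0 < ω ∧ 0 < η + (η - 1) * ω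

/-- ω̄ = 1/(1+ω) along a root branch W, as a function of t = σ². -/
noncomputable def obarFun (W : ℝ → ℝ) (t : ℝ) : ℝ := 1 / (1 + W t)

/-- δ = (κ/t)(η − ω/(1+ω)) along a root branch W, as a function of t = σ². -/
noncomputable def deltaFun (η κ : ℝ) (W : ℝ → ℝ) (t : ℝ) : ℝ :=
  κ / t * (η - W t / (1 + W t))

/-- Δ_{σ²} = σ² + κωω̄²/(δ(1 + δω̄²)) along a root branch W. -/
noncomputable def DeltaFun (η κ : ℝ) (W : ℝ → ℝ) (t : ℝ) : ℝ :=
  t + κ * W t * obarFun W t ^ 2 / (deltaFun η κ W t * (1 + deltaFun η κ W t * obarFun W t ^ 2))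

/-- Ξ = (1 + δω̄²)δΔ_{σ²}/(ηκ(1 + δω̄)) along a root branch W. -/
noncomputable def XiFun (η κ : ℝ) (W : ℝ → ℝ) (t : ℝ) : ℝ :=
  (1 + deltaFun η κ W t * obarFun W t ^ 2) * deltaFun η κ W t * DeltaFun η κ W t
    / (η * κ * (1 + deltaFun η κ W t * obarFun W t))

/-- V₋ = −ρ log Ξ + η + σ⁴δ'/κ, where δ' is the derivative of δ with respect to σ²
along the root branch W, evaluated at t = σ². -/
noncomputable def Vminus (η κ ρ : ℝ) (W : ℝ → ℝ) (t : ℝ) : ℝ :=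
  -ρ * Real.log (XiFun η κ W t) + η + t ^ 2 * deriv (deltaFun η κ W) t / κ

/-- V₊ = V₋ + κω̄⁴(ω²(1+δω̄)/(1+δω̄²) − ωω'/(δ(1+δω̄²))), where ω' is the derivative of ω
with respect to σ² along the root branch W, evaluated at t = σ². -/
noncomputable def Vplus (η κ ρ : ℝ) (W : ℝ → ℝ) (t : ℝ) : ℝ :=
  Vminus η κ ρ W t + κ * obarFun W t ^ 4 *
    ((W t) ^ 2 * (1 + deltaFun η κ W t * obarFun W t)
        / (1 + deltaFun η κ W t * obarFun W t ^ 2)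
      - W t * deriv W t / (deltaFun η κ W t * (1 + deltaFun η κ W t * obarFun W t ^ 2)))

/-- The product `(1 - u)(η - u)(1 - κu)`. In the variable `u = ω/(1+ω)` the cubic equation reads
`t * u = rootProd η κ u`. -/
noncomputable def rootProd (η κ u : ℝ) : ℝ := (1 - u) * (η - u) * (1 - κ * u)

/-- Minus `u ^ 2` times the derivative of `rootProd η κ u / u`. -/
noncomputable def slopeNum (η κ u : ℝ) : ℝ :=
  rootProd η κ u
    + u * ((η - u) * (1 - κ * u) + (1 - u) * (1 - κ * u) + κ * ((1 - u) * (η - u)))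

/-- The interval of values of `u = ω/(1+ω)` corresponding to the selected roots. -/
def admissible (η κ : ℝ) : Set ℝ := {u | 0 < u ∧ u < 1 ∧ u < η ∧ κ * u < 1}

/-- `Ξ` as a function of `u = ω/(1+ω)`. -/
noncomputable def xiPoly (η κ u : ℝ) : ℝ :=
  ((η - u) * (1 - κ * u ^ 2) + u * (1 - κ * u) * (1 - u)) / η

/-- `V₋` as a function of `u = ω/(1+ω)`. -/
noncomputable def vMinusOf (η κ ρ u : ℝ) : ℝ :=
  -ρ * Real.log (xiPoly η κ u) + u + u * rootProd η κ u / slopeNum η κ u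

/-- `V₊ - V₋` as a function of `u = ω/(1+ω)`. -/
noncomputable def vGapOf (η κ u : ℝ) : ℝ :=
  (1 - u) ^ 2 * u ^ 2 / (1 - κ * u ^ 2) * (κ + (1 - κ * u) ^ 2 / slopeNum η κ u)

theorem isOpen_admissible (η κ : ℝ) : IsOpen (admissible η κ) := by
  refine (isOpen_lt continuous_const continuous_id).inter ((isOpen_lt continuous_id
    continuous_const).inter ((isOpen_lt continuous_id continuous_const).inter
    (isOpen_lt (continuous_const.mul continuous_id) continuous_const)))

theorem one_sub_mul_sq_pos {η κ u : ℝ} (hu : u ∈ admissible η κ) : 0 < 1 - κ * u ^ 2 := by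
  obtain ⟨h0, h1, h2, h3⟩ := hu
  nlinarith [mul_pos h0 (sub_pos.2 h3)]

theorem slopeNum_pos {η κ u : ℝ} (hκ : 0 < κ) (hu : u ∈ admissible η κ) :
    0 < slopeNum η κ u := by
  obtain ⟨h0, h1, h2, h3⟩ := hu
  have h1' := sub_pos.2 h1
  have h2' := sub_pos.2 h2
  have h3' := sub_pos.2 h3
  unfold slopeNum rootProd
  positivity

theorem IsSelRoot.admissible {η κ t ω : ℝ} (ht : 0 < t) (h : IsSelRoot η κ t ω) :
    ω / (1 + ω) ∈ admissible η κ ∧ t * (ω / (1 + ω)) = rootProd η κ (ω / (1 + ω)) := by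
  obtain ⟨hc, hω, hA⟩ := h
  have hω1 : 0 < 1 + ω := by linarith
  have key : t * ω * (1 + ω) ^ 2 = (η + (η - 1) * ω) * (1 + ω - κ * ω) := by
    unfold cubicEq at hc
    field_simp at hc
    linear_combination hc
  have hB : 0 < 1 + ω - κ * ω := pos_of_mul_pos_right (key ▸ by positivity) hA.le
  refine ⟨⟨by positivity, ?_, ?_, ?_⟩, ?_⟩
  · rw [div_lt_one hω1]; linarith
  · rw [div_lt_iff₀ hω1]; linarith
  · rw [mul_div_assoc', div_lt_one hω1]; linarith
  · unfold rootProd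
    field_simp
    linear_combination key

theorem hasStrictDerivAt_rootProd_div (η κ : ℝ) {u : ℝ} (hu : u ≠ 0) :
    HasStrictDerivAt (fun x => rootProd η κ x / x) (-slopeNum η κ u / u ^ 2) u := by
  have hid := hasStrictDerivAt_id u
  have h := ((((hid.const_sub 1).mul (hid.const_sub η)).mul
    ((hid.const_mul κ).const_sub 1)).div hid hu)
  refine h.congr_deriv ?_
  simp only [slopeNum, rootProd, id, Pi.mul_apply]
  field_simp
  ring

theorem strictAntiOn_rootProd_div {η κ : ℝ} (hκ : 0 < κ) :
    StrictAntiOn (fun x => rootProd η κ x / x) (admissible η κ) := by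
  rintro a ⟨a0, a1, a2, a3⟩ b ⟨b0, b1, b2, b3⟩ hab
  have a1' := sub_pos.2 a1
  have b1' := sub_pos.2 b1
  have b2' := sub_pos.2 b2
  have b3' := sub_pos.2 b3
  unfold rootProd
  dsimp only
  gcongr

/-- A solution branch of `t * u = rootProd η κ u` is differentiable. -/
theorem hasDerivAt_branch {η κ : ℝ} (hκ : 0 < κ) {u : ℝ → ℝ}
    (hu : ∀ t > 0, u t ∈ admissible η κ ∧ t * u t = rootProd η κ (u t)) {t : ℝ} (ht : 0 < t) :
    HasDerivAt u (-(u t) ^ 2 / slopeNum η κ (u t)) t := by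
  obtain ⟨hmem, heq⟩ := hu t ht
  have hpos : 0 < u t := hmem.1
  have hS := slopeNum_pos hκ hmem
  have hT : ∀ s > 0, rootProd η κ (u s) / u s = s := fun s hs => by
    rw [← (hu s hs).2, mul_div_cancel_right₀ _ (hu s hs).1.1.ne']
  have hd := hasStrictDerivAt_rootProd_div η κ hpos.ne'
  have hne : -slopeNum η κ (u t) / u t ^ 2 ≠ 0 :=
    div_ne_zero (neg_ne_zero.2 hS.ne') (pow_pos hpos 2).ne'
  have hg := hd.to_localInverse hne
  have hr := HasStrictFDerivAt.eventually_right_inverse (hd.hasStrictFDerivAt_equiv hne)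
  have hgt : HasStrictDerivAt.localInverse (fun x => rootProd η κ x / x) _ (u t) hd hne
      (rootProd η κ (u t) / u t) = u t :=
    HasStrictFDerivAt.localInverse_apply_image (hd.hasStrictFDerivAt_equiv hne)
  have hcont := hg.hasDerivAt.continuousAt.tendsto
  rw [hgt] at hcont
  have hadm := hcont.eventually ((isOpen_admissible η κ).mem_nhds hmem)
  rw [hT t ht] at hg hr hadm
  refine (hg.hasDerivAt.congr_of_eventuallyEq ?_).congr_deriv ?_
  · filter_upwards [hr, hadm, lt_mem_nhds ht] with s hs hsa hs0
    refine (strictAntiOn_rootProd_div hκ).injOn (hu s hs0).1 hsa ?_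
    exact (hT s hs0).trans hs.symm
  · rw [inv_div, neg_div, div_neg]

section Branch

variable {η κ : ℝ} {W : ℝ → ℝ}

theorem hasDerivAt_ratio (hκ : 0 < κ) (hW : ∀ t > 0, IsSelRoot η κ t (W t))
    {t : ℝ} (ht : 0 < t) :
    HasDerivAt (fun s => W s / (1 + W s))
      (-(W t / (1 + W t)) ^ 2 / slopeNum η κ (W t / (1 + W t))) t :=
  hasDerivAt_branch (u := fun s => W s / (1 + W s)) hκ (fun s hs => (hW s hs).admissible hs) ht

theorem deriv_selRoot (hκ : 0 < κ) (hW : ∀ t > 0, IsSelRoot η κ t (W t))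
    {t u : ℝ} (ht : 0 < t) (hu : u = W t / (1 + W t)) :
    deriv W t = -u ^ 2 / (slopeNum η κ u * (1 - u) ^ 2) := by
  have hd := hasDerivAt_ratio hκ hW ht
  have hmem := ((hW t ht).admissible ht).1
  rw [← hu] at hd hmem
  have h1 : 1 - W t / (1 + W t) ≠ 0 := hu ▸ (sub_pos.2 hmem.2.1).ne'
  have hS := (slopeNum_pos hκ hmem).ne'
  have h := hd.div (hd.const_sub 1) h1
  rw [← hu] at h h1
  have hEq : W =ᶠ[𝓝 t] fun s => W s / (1 + W s) / (1 - W s / (1 + W s)) := by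
    filter_upwards [lt_mem_nhds ht] with s hs
    have : 1 + W s ≠ 0 := by linarith [(hW s hs).2.1]
    field_simp
    ring
  rw [(h.congr_of_eventuallyEq hEq).deriv]
  field_simp
  ring

theorem deriv_deltaFun (hκ : 0 < κ) (hW : ∀ t > 0, IsSelRoot η κ t (W t))
    {t u : ℝ} (ht : 0 < t) (hu : u = W t / (1 + W t)) :
    t ^ 2 * deriv (deltaFun η κ W) t / κ = -(η - u) + u * rootProd η κ u / slopeNum η κ u := by
  have hd := hasDerivAt_ratio hκ hW ht
  obtain ⟨hmem, heq⟩ := (hW t ht).admissible ht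
  rw [← hu] at hd hmem heq
  have hS := (slopeNum_pos hκ hmem).ne'
  have h := ((hasDerivAt_id t).fun_inv ht.ne').const_mul κ |>.mul (hd.const_sub η)
  have h' : HasDerivAt (deltaFun η κ W) _ t := h
  rw [h'.deriv, ← hu, ← heq]
  simp only [id]
  field_simp

/-- The value of `ω̄`, `ω` and `δ` in terms of `u = ω/(1+ω)`. -/
theorem branch_values (hW : ∀ t > 0, IsSelRoot η κ t (W t))
    {t u : ℝ} (ht : 0 < t) (hu : u = W t / (1 + W t)) :
    obarFun W t = 1 - u ∧ W t = u / (1 - u) ∧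
      deltaFun η κ W t = κ * u / ((1 - u) * (1 - κ * u)) := by
  obtain ⟨hmem, heq⟩ := (hW t ht).admissible ht
  rw [← hu] at hmem heq
  obtain ⟨h0, h1, h2, h3⟩ := hmem
  have h1' := (sub_pos.2 h1).ne'
  have h3' := (sub_pos.2 h3).ne'
  have hω : 1 + W t ≠ 0 := by linarith [(hW t ht).2.1]
  refine ⟨?_, ?_, ?_⟩
  · rw [obarFun, hu]; field_simp; ring
  · rw [eq_div_iff h1', hu]; field_simp; ring
  · rw [deltaFun, ← hu]
    unfold rootProd at heq
    rw [eq_div_iff (mul_ne_zero h1' h3'), div_mul_eq_mul_div, div_mul_eq_mul_div,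
      div_eq_iff ht.ne']
    linear_combination -κ * heq

theorem XiFun_eq (hη : 0 < η) (hκ : 0 < κ) (hW : ∀ t > 0, IsSelRoot η κ t (W t))
    {t u : ℝ} (ht : 0 < t) (hu : u = W t / (1 + W t)) :
    XiFun η κ W t = xiPoly η κ u := by
  obtain ⟨hmem, heq⟩ := (hW t ht).admissible ht
  obtain ⟨ho, hw, hδ⟩ := branch_values hW ht hu
  rw [← hu] at hmem heq
  have hC := (one_sub_mul_sq_pos hmem).ne'
  obtain ⟨h0, h1, h2, h3⟩ := hmem
  have h1' := (sub_pos.2 h1).ne'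
  have h3' := (sub_pos.2 h3).ne'
  have hts : t = (1 - u) * (η - u) * (1 - κ * u) / u := by
    rw [eq_div_iff h0.ne']; exact heq
  have e1 : 1 + κ * u / ((1 - u) * (1 - κ * u)) * (1 - u) = 1 / (1 - κ * u) := by
    field_simp; ring
  have e2 : 1 + κ * u / ((1 - u) * (1 - κ * u)) * (1 - u) ^ 2
      = (1 - κ * u ^ 2) / (1 - κ * u) := by
    field_simp; ring
  rw [XiFun, DeltaFun, ho, hδ, hw, e1, e2, hts, xiPoly]
  field_simp

theorem Vminus_eq (hη : 0 < η) (hκ : 0 < κ) (ρ : ℝ) (hW : ∀ t > 0, IsSelRoot η κ t (W t))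
    {t : ℝ} (ht : 0 < t) :
    Vminus η κ ρ W t = vMinusOf η κ ρ (W t / (1 + W t)) := by
  rw [Vminus, vMinusOf, XiFun_eq hη hκ hW ht rfl, deriv_deltaFun hκ hW ht rfl]
  ring

theorem Vplus_eq (hη : 0 < η) (hκ : 0 < κ) (ρ : ℝ) (hW : ∀ t > 0, IsSelRoot η κ t (W t))
    {t : ℝ} (ht : 0 < t) :
    Vplus η κ ρ W t
      = vMinusOf η κ ρ (W t / (1 + W t)) + vGapOf η κ (W t / (1 + W t)) := by
  obtain ⟨hmem, -⟩ := (hW t ht).admissible ht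
  rw [Vplus, Vminus_eq hη hκ ρ hW ht]
  congr 1
  obtain ⟨u, hu⟩ : ∃ u, u = W t / (1 + W t) := ⟨_, rfl⟩
  obtain ⟨ho, hw, hδ⟩ := branch_values hW ht hu
  rw [← hu] at hmem ⊢
  have hC := (one_sub_mul_sq_pos hmem).ne'
  have hS := (slopeNum_pos hκ hmem).ne'
  obtain ⟨h0, h1, h2, h3⟩ := hmem
  have h1' := (sub_pos.2 h1).ne'
  have h3' := (sub_pos.2 h3).ne'
  have e1 : 1 + κ * u / ((1 - u) * (1 - κ * u)) * (1 - u) = 1 / (1 - κ * u) := by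
    field_simp; ring
  have e2 : 1 + κ * u / ((1 - u) * (1 - κ * u)) * (1 - u) ^ 2
      = (1 - κ * u ^ 2) / (1 - κ * u) := by
    field_simp; ring
  rw [deriv_selRoot hκ hW ht hu, ho, hδ, hw, e1, e2, vGapOf]
  field_simp
  ring

/-- If `u = ω/(1+ω)` stays within `O(t)` of a point `m` where the expressions for `V₋` and `V₊`
in terms of `u` are smooth, then `V₋` and `V₊` stay within `O(t)` of their values at `m`. -/
theorem isBigO_of_bound {ρ m c : ℝ} (hη : 0 < η) (hκ : 0 < κ)
    (hW : ∀ t > 0, IsSelRoot η κ t (W t)) (hc : 0 < c)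
    (hbound : ∀ t > 0, c * |W t / (1 + W t) - m| ≤ t)
    (hxi : xiPoly η κ m ≠ 0) (hS : slopeNum η κ m ≠ 0) (hC : 1 - κ * m ^ 2 ≠ 0) :
    (fun t => Vminus η κ ρ W t - vMinusOf η κ ρ m) =O[𝓝[>] (0 : ℝ)] (fun t => t) ∧
    (fun t => Vplus η κ ρ W t - (vMinusOf η κ ρ m + vGapOf η κ m))
      =O[𝓝[>] (0 : ℝ)] (fun t => t) := by
  have hO : (fun t => W t / (1 + W t) - m) =O[𝓝[>] (0 : ℝ)] (fun t => t) := by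
    refine IsBigO.of_bound c⁻¹ ?_
    filter_upwards [self_mem_nhdsWithin] with t ht
    have ht : 0 < t := ht
    rw [Real.norm_eq_abs, Real.norm_eq_abs, abs_of_pos ht, inv_mul_eq_div, le_div_iff₀' hc]
    exact hbound t ht
  have hlim : Tendsto (fun t => W t / (1 + W t)) (𝓝[>] (0 : ℝ)) (𝓝 m) := by
    rw [← tendsto_sub_nhds_zero_iff]
    exact hO.trans_tendsto (tendsto_id.mono_left nhdsWithin_le_nhds)
  have hP : Differentiable ℝ (rootProd η κ) := by unfold rootProd; fun_prop
  have hSd : Differentiable ℝ (slopeNum η κ) := by unfold slopeNum; fun_prop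
  have hxd : Differentiable ℝ (xiPoly η κ) := by unfold xiPoly; fun_prop
  have hV : DifferentiableAt ℝ (vMinusOf η κ ρ) m := by
    have hP := hP m
    have hSd := hSd m
    have hxd := hxd m
    unfold vMinusOf
    fun_prop (disch := assumption)
  have hG : DifferentiableAt ℝ (vGapOf η κ) m := by
    have hSd := hSd m
    unfold vGapOf
    fun_prop (disch := assumption)
  constructor
  · refine ((hV.isBigO_sub.comp_tendsto hlim).trans hO).congr' ?_ EventuallyEq.rfl
    filter_upwards [self_mem_nhdsWithin] with t ht
    rw [Vminus_eq hη hκ ρ hW ht]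
    rfl
  · refine (((hV.add hG).isBigO_sub.comp_tendsto hlim).trans hO).congr' ?_ EventuallyEq.rfl
    filter_upwards [self_mem_nhdsWithin] with t ht
    rw [Vplus_eq hη hκ ρ hW ht]
    rfl

end Branch

/-- High SNR approximation: as σ² → 0 (with η, κ, ρ fixed), along the branch of selected
roots, (i) if κ < 1 and η > 1, then V₋ = −ρ·log((1−κ)(1−η⁻¹)) + 1 + O(σ²) and
V₊ = −ρ·log((1−κ)(1−η⁻¹)) + 1 + O(σ²); (ii) if η < 1 and ηκ < 1, then
V₋ = −ρ·log((1−η)(1−ηκ)) + η + O(σ²) and V₊ = −ρ·log((1−η)(1−ηκ)) + η(2−η) + O(σ²);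
(iii) if (κ > 1 and η > 1) or (ηκ > 1 and η < 1), then
V₋ = −ρ·log((1−κ⁻¹)(1−(ηκ)⁻¹)) + 1/κ + O(σ²) and
V₊ = −ρ·log((1−κ⁻¹)(1−(ηκ)⁻¹)) + 1/κ + (κ−1)/κ² + O(σ²). -/
theorem high_SNR_approximation
    (η κ ρ : ℝ) (hη : 0 < η) (hκ : 0 < κ) (hρ : 0 < ρ)
    (W : ℝ → ℝ) (hW : ∀ t > 0, IsSelRoot η κ t (W t)) :
    ((κ < 1 ∧ 1 < η) →
      (fun t => Vminus η κ ρ W t - (-ρ * Real.log ((1 - κ) * (1 - η⁻¹)) + 1))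
          =O[𝓝[>] (0 : ℝ)] (fun t => t) ∧
      (fun t => Vplus η κ ρ W t - (-ρ * Real.log ((1 - κ) * (1 - η⁻¹)) + 1))
          =O[𝓝[>] (0 : ℝ)] (fun t => t)) ∧
    ((η < 1 ∧ η * κ < 1) →
      (fun t => Vminus η κ ρ W t - (-ρ * Real.log ((1 - η) * (1 - η * κ)) + η))
          =O[𝓝[>] (0 : ℝ)] (fun t => t) ∧
      (fun t => Vplus η κ ρ W t - (-ρ * Real.log ((1 - η) * (1 - η * κ)) + η * (2 - η)))
          =O[𝓝[>] (0 : ℝ)] (fun t => t)) ∧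
    (((1 < κ ∧ 1 < η) ∨ (1 < η * κ ∧ η < 1)) →
      (fun t => Vminus η κ ρ W t - (-ρ * Real.log ((1 - κ⁻¹) * (1 - (η * κ)⁻¹)) + 1 / κ))
          =O[𝓝[>] (0 : ℝ)] (fun t => t) ∧
      (fun t => Vplus η κ ρ W t
          - (-ρ * Real.log ((1 - κ⁻¹) * (1 - (η * κ)⁻¹)) + 1 / κ + (κ - 1) / κ ^ 2))
          =O[𝓝[>] (0 : ℝ)] (fun t => t)) := by
  have hu := fun t (ht : t > 0) => (hW t ht).admissible ht
  refine ⟨?_, ?_, ?_⟩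
  · rintro ⟨hκ1, hη1⟩
    have a := sub_pos.2 hκ1
    have b := sub_pos.2 hη1
    have hxi : xiPoly η κ 1 = (1 - κ) * (1 - η⁻¹) := by
      unfold xiPoly; field_simp; ring
    have hP : rootProd η κ 1 = 0 := by unfold rootProd; ring
    have hS : slopeNum η κ 1 = (η - 1) * (1 - κ) := by unfold slopeNum rootProd; ring
    have hV : vMinusOf η κ ρ 1 = -ρ * Real.log ((1 - κ) * (1 - η⁻¹)) + 1 := by
      rw [vMinusOf, hxi, hP]; ring
    have hG : vGapOf η κ 1 = 0 := by unfold vGapOf; ring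
    have h := isBigO_of_bound (ρ := ρ) (m := 1) hη hκ hW (mul_pos b a) (fun t ht => ?_)
      (hxi ▸ (mul_pos a (sub_pos.2 (inv_lt_one_of_one_lt₀ hη1))).ne')
      (hS ▸ (mul_pos b a).ne') (by linarith)
    · rw [hV, hG, add_zero] at h
      exact h
    · obtain ⟨⟨h0, h1, h2, h3⟩, heq⟩ := hu t ht
      generalize W t / (1 + W t) = u at *
      rw [abs_of_neg (sub_neg.2 h1)]
      have h1' := sub_pos.2 h1
      calc (η - 1) * (1 - κ) * -(u - 1) = (1 - u) * (η - 1) * (1 - κ * 1) := by ring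
        _ ≤ (1 - u) * (η - u) * (1 - κ * u) := by gcongr; linarith
        _ = t * u := heq.symm
        _ ≤ t := mul_le_of_le_one_right ht.le h1.le
  · rintro ⟨hη1, hηκ⟩
    have a := sub_pos.2 hη1
    have b := sub_pos.2 hηκ
    have hC : 0 < 1 - κ * η ^ 2 := by nlinarith
    have hxi : xiPoly η κ η = (1 - η) * (1 - η * κ) := by
      unfold xiPoly; field_simp; ring
    have hP : rootProd η κ η = 0 := by unfold rootProd; ring
    have hS : slopeNum η κ η = η * ((1 - η) * (1 - η * κ)) := by
      unfold slopeNum rootProd; ring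
    have hV : vMinusOf η κ ρ η = -ρ * Real.log ((1 - η) * (1 - η * κ)) + η := by
      rw [vMinusOf, hxi, hP]; ring
    have hG : vGapOf η κ η = η * (2 - η) - η := by
      have a' := a.ne'
      have b' := b.ne'
      have hC' := hC.ne'
      rw [vGapOf, hS, mul_comm κ η, div_mul_eq_mul_div, div_eq_iff hC']; field_simp; ring
    have h := isBigO_of_bound (ρ := ρ) (m := η) hη hκ hW (mul_pos a b) (fun t ht => ?_)
      (hxi ▸ (mul_pos a b).ne') (hS ▸ (mul_pos hη (mul_pos a b)).ne') hC.ne'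
    · rw [hV, hG, add_assoc, add_sub_cancel] at h
      exact h
    · obtain ⟨⟨h0, h1, h2, h3⟩, heq⟩ := hu t ht
      generalize W t / (1 + W t) = u at *
      rw [abs_of_neg (sub_neg.2 h2)]
      have h2' := sub_pos.2 h2
      calc (1 - η) * (1 - η * κ) * -(u - η) = (1 - η) * (η - u) * (1 - κ * η) := by ring
        _ ≤ (1 - u) * (η - u) * (1 - κ * u) := by gcongr; linarith
        _ = t * u := heq.symm
        _ ≤ t := mul_le_of_le_one_right ht.le h1.le
  · intro hcase
    have hκ1 : 1 < κ := by
      rcases hcase with h | h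
      · exact h.1
      · nlinarith
    have hηκ : 1 < η * κ := by
      rcases hcase with h | h
      · nlinarith
      · exact h.1
    have a := sub_pos.2 (inv_lt_one_of_one_lt₀ hκ1)
    have b := sub_pos.2 (inv_lt_one_of_one_lt₀ hηκ)
    have hm : 0 < η - κ⁻¹ := by
      rw [sub_pos, inv_lt_iff_one_lt_mul₀ hκ]; exact hηκ
    have hxi : xiPoly η κ κ⁻¹ = (1 - κ⁻¹) * (1 - (η * κ)⁻¹) := by
      unfold xiPoly; field_simp; ring
    have hP : rootProd η κ κ⁻¹ = 0 := by
      rw [rootProd, mul_inv_cancel₀ hκ.ne']; ring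
    have hS : slopeNum η κ κ⁻¹ = (1 - κ⁻¹) * (η - κ⁻¹) := by
      rw [slopeNum, hP, mul_inv_cancel₀ hκ.ne']; field_simp; ring
    have hV : vMinusOf η κ ρ κ⁻¹
        = -ρ * Real.log ((1 - κ⁻¹) * (1 - (η * κ)⁻¹)) + 1 / κ := by
      rw [vMinusOf, hxi, hP]; ring
    have hC : 1 - κ * κ⁻¹ ^ 2 = 1 - κ⁻¹ := by field_simp
    have hG : vGapOf η κ κ⁻¹ = (κ - 1) / κ ^ 2 := by
      rw [vGapOf, hC, mul_inv_cancel₀ hκ.ne', sub_self, zero_pow two_ne_zero, zero_div, add_zero,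
        pow_two, mul_assoc, mul_div_cancel_left₀ _ a.ne']
      field_simp
    have h := isBigO_of_bound (ρ := ρ) (m := κ⁻¹) hη hκ hW (mul_pos hκ (mul_pos a hm))
      (fun t ht => ?_) (hxi ▸ (mul_pos a b).ne') (hS ▸ (mul_pos a hm).ne') (hC ▸ a.ne')
    · rw [hV, hG] at h
      exact h
    · obtain ⟨⟨h0, h1, h2, h3⟩, heq⟩ := hu t ht
      generalize W t / (1 + W t) = u at *
      have hlt : u < κ⁻¹ := by rw [lt_inv_comm₀ h0 hκ, ← one_div, lt_div_iff₀ h0]; exact h3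
      rw [abs_of_neg (sub_neg.2 hlt)]
      have h3' := sub_pos.2 h3
      calc κ * ((1 - κ⁻¹) * (η - κ⁻¹)) * -(u - κ⁻¹)
          = (1 - κ⁻¹) * (η - κ⁻¹) * (κ * κ⁻¹ - κ * u) := by ring
        _ = (1 - κ⁻¹) * (η - κ⁻¹) * (1 - κ * u) := by rw [mul_inv_cancel₀ hκ.ne']
        _ ≤ (1 - u) * (η - u) * (1 - κ * u) := by gcongr
        _ = t * u := heq.symm
        _ ≤ t := mul_le_of_le_one_right ht.le h1.le
end

section
/- Two-point symmetry identity for the cubic root system: fix η > 0, κ > 0 and σ², z > 0. Let ω and ω_z be the selected roots of the cubic at parameters σ² and z respectively, and set ω̄ = 1/(1+ω), ω̄_z = 1/(1+ω_z), δ = (κ/σ²)(η − ωω̄), δ_z = (κ/z)(η − ω_zω̄_z). Then ω/(δ(1 + δ_z ω̄ ω̄_z)) = ω_z/(δ_z(1 + δ ω̄ ω̄_z)). -/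
/-- At a selected root, the cubic equation says `κ ω = δ (1 - κ ω ω̄)`, where `δ` is positive. -/
theorem selRoot_relation {η κ t ω ob δ : ℝ} (hκ : 0 < κ) (ht : 0 < t) (h : IsSelRoot η κ t ω)
    (hob : ob = 1 / (1 + ω)) (hδ : δ = κ / t * (η - ω * ob)) :
    0 < δ ∧ κ * ω = δ * (1 - κ * (ω * ob)) := by
  obtain ⟨hc, hω, hN⟩ := h
  have hδ' : δ = κ * (η + (η - 1) * ω) / (t * (1 + ω)) := by
    rw [hδ, hob]
    field_simp
    ring
  refine ⟨by rw [hδ']; positivity, ?_⟩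
  unfold cubicEq at hc
  field_simp at hc
  rw [hδ', hob]
  field_simp
  linear_combination hc

/-- Two-point symmetry identity for the cubic root system: with ω, ω_z the selected roots at
σ² and z, ω̄ = 1/(1+ω), ω̄_z = 1/(1+ω_z), δ = (κ/σ²)(η − ωω̄), δ_z = (κ/z)(η − ω_zω̄_z), one has
ω/(δ(1 + δ_z ω̄ ω̄_z)) = ω_z/(δ_z(1 + δ ω̄ ω̄_z)). -/
theorem two_point_symmetry_identity
    (η κ s z : ℝ) (hη : 0 < η) (hκ : 0 < κ) (hs : 0 < s) (hz : 0 < z)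
    (ω ωz : ℝ) (hω : IsSelRoot η κ s ω) (hωz : IsSelRoot η κ z ωz)
    (ob obz δ δz : ℝ)
    (hob : ob = 1 / (1 + ω)) (hobz : obz = 1 / (1 + ωz))
    (hδ : δ = κ / s * (η - ω * ob)) (hδz : δz = κ / z * (η - ωz * obz)) :
    ω / (δ * (1 + δz * ob * obz)) = ωz / (δz * (1 + δ * ob * obz)) := by
  have hpos : 0 < ω := hω.2.1
  have hposz : 0 < ωz := hωz.2.1
  obtain ⟨hd, hr⟩ := selRoot_relation hκ hs hω hob hδ
  obtain ⟨hdz, hrz⟩ := selRoot_relation hκ hz hωz hobz hδz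
  have hb : ω * ob = 1 - ob := by rw [hob]; field_simp; ring
  have hbz : ωz * obz = 1 - obz := by rw [hobz]; field_simp; ring
  have hob0 : 0 < ob := by rw [hob]; positivity
  have hobz0 : 0 < obz := by rw [hobz]; positivity
  rw [div_eq_div_iff (by positivity) (by positivity)]
  apply mul_left_cancel₀ hκ.ne'
  linear_combination δz * hr - δ * hrz + κ * δ * δz * (obz - 1) * hb
    - κ * δ * δz * (ob - 1) * hbz
end

section
/- Existence and uniqueness of the fundamental root: for all η > 0, κ > 0 and σ² > 0, the cubic equation ω³ + (2σ² + ηκ − κ − η + 1)ω²/σ² + (1 + ηκ/σ² − 2η/σ² + 1/σ²)ω − η/σ² = 0 has exactly one real root ω satisfying ω > 0 and η + (η−1)ω > 0; moreover this root also satisfies η − ω/(1+ω) > 0 and 1 + (1−κ)ω > 0. -/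
/-- After clearing the denominator, the cubic equation factors. -/
theorem cubicEq_iff_factored {η κ t ω : ℝ} (ht : 0 < t) :
    cubicEq η κ t ω ↔
      t * ω * (1 + ω) ^ 2 = (η + (η - 1) * ω) * (1 + (1 - κ) * ω) := by
  have key : t * (ω ^ 3 + (2 * t + η * κ - κ - η + 1) * ω ^ 2 / t
      + (1 + η * κ / t - 2 * η / t + 1 / t) * ω - η / t)
      = t * ω * (1 + ω) ^ 2 - (η + (η - 1) * ω) * (1 + (1 - κ) * ω) := by
    field_simp
    ring
  unfold cubicEq
  rw [← sub_eq_zero (a := t * ω * (1 + ω) ^ 2), ← key, mul_eq_zero_iff_left ht.ne']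

theorem second_factor_pos_of_cubicEq {η κ t ω : ℝ} (ht : 0 < t) (h : cubicEq η κ t ω)
    (hω : 0 < ω) (hA : 0 < η + (η - 1) * ω) : 0 < 1 + (1 - κ) * ω := by
  rw [cubicEq_iff_factored ht] at h
  have h_pos : 0 < t * ω * (1 + ω) ^ 2 := by positivity
  rw [h] at h_pos
  exact (pos_iff_pos_of_mul_pos h_pos).mp hA

theorem not_lt_of_cubicEq {η κ t a b : ℝ} (hκ : 0 < κ) (ht : 0 < t)
    (ha : cubicEq η κ t a) (ha0 : 0 < a)
    (hb : cubicEq η κ t b) (hb0 : 0 < b) (hbA : 0 < η + (η - 1) * b) : ¬ a < b := by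
  intro hab
  have hbB := second_factor_pos_of_cubicEq ht hb hb0 hbA
  rw [cubicEq_iff_factored ht] at ha hb
  have hA : (η + (η - 1) * b) * (1 + a) < (η + (η - 1) * a) * (1 + b) := by linarith
  have hB : (1 + (1 - κ) * b) * (1 + a) < (1 + (1 - κ) * a) * (1 + b) := by
    linarith [mul_lt_mul_of_pos_left hab hκ]
  have hAB := mul_lt_mul'' hA hB (by positivity) (by positivity)
  have h_lt : t * b * ((1 + a) ^ 2 * (1 + b) ^ 2) < t * a * ((1 + a) ^ 2 * (1 + b) ^ 2) := by
    linear_combination hAB + (1 + a) ^ 2 * hb - (1 + b) ^ 2 * ha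
  have h_gt : t * a * ((1 + a) ^ 2 * (1 + b) ^ 2) < t * b * ((1 + a) ^ 2 * (1 + b) ^ 2) := by
    gcongr
  exact lt_asymm h_lt h_gt

theorem exists_cubicEq_of_sign_change {η κ t c : ℝ} (hη : 0 < η) (ht : 0 < t) (hc : 0 < c)
    (h : (η + (η - 1) * c) * (1 + (1 - κ) * c) < t * c * (1 + c) ^ 2) :
    ∃ ω, cubicEq η κ t ω ∧ 0 < ω ∧ ω < c := by
  have hcont : ContinuousOn (fun ω : ℝ => t * ω * (1 + ω) ^ 2
      - (η + (η - 1) * ω) * (1 + (1 - κ) * ω)) (Set.Icc 0 c) := by fun_prop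
  obtain ⟨ω, hω, hroot⟩ := intermediate_value_Ioo hc.le hcont
    (show (0 : ℝ) ∈ _ from ⟨by simpa using hη, sub_pos.mpr h⟩)
  exact ⟨ω, (cubicEq_iff_factored ht).mpr (sub_eq_zero.mp hroot), hω.1, hω.2⟩

theorem exists_fundamental_root {η κ t : ℝ} (hη : 0 < η) (hκ : 0 < κ) (ht : 0 < t) :
    ∃ ω, cubicEq η κ t ω ∧ 0 < ω ∧ 0 < η + (η - 1) * ω := by
  rcases lt_or_ge η 1 with h1 | h1
  · have hd : 0 < 1 - η := sub_pos.mpr h1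
    have hc : 0 < η / (1 - η) := by positivity
    have hz : η + (η - 1) * (η / (1 - η)) = 0 := by
      field_simp
      ring
    obtain ⟨ω, hroot, h0, hlt⟩ := exists_cubicEq_of_sign_change (κ := κ) hη ht hc
      (by rw [hz, zero_mul]; positivity)
    refine ⟨ω, hroot, h0, ?_⟩
    linarith [mul_lt_mul_of_pos_left hlt hd]
  · have hc : 0 < η / t := by positivity
    have htc : t * (η / t) = η := by field_simp
    have hA : 0 < η + (η - 1) * (η / t) := by
      have := mul_nonneg (sub_nonneg.mpr h1) hc.le
      linarith
    obtain ⟨ω, hroot, h0, -⟩ := exists_cubicEq_of_sign_change (κ := κ) hη ht hc (by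
      rw [htc]
      calc (η + (η - 1) * (η / t)) * (1 + (1 - κ) * (η / t))
          < (η + (η - 1) * (η / t)) * (1 + η / t) := by
            refine mul_lt_mul_of_pos_left ?_ hA
            linarith [mul_pos hκ hc]
        _ < (η * (1 + η / t)) * (1 + η / t) := by
            refine mul_lt_mul_of_pos_right ?_ (by positivity)
            linarith
        _ = η * (1 + η / t) ^ 2 := by ring)
    refine ⟨ω, hroot, h0, ?_⟩
    have := mul_nonneg (sub_nonneg.mpr h1) h0.le
    linarith

/-- Existence and uniqueness of the fundamental root: for all η > 0, κ > 0 and σ² > 0, the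
cubic equation has exactly one real root ω satisfying ω > 0 and η + (η−1)ω > 0; moreover this
root also satisfies η − ω/(1+ω) > 0 and 1 + (1−κ)ω > 0. -/
theorem existence_uniqueness_fundamental_root
    (η κ s : ℝ) (hη : 0 < η) (hκ : 0 < κ) (hs : 0 < s) :
    (∃! ω : ℝ, cubicEq η κ s ω ∧ 0 < ω ∧ 0 < η + (η - 1) * ω) ∧
    (∀ ω : ℝ, cubicEq η κ s ω → 0 < ω → 0 < η + (η - 1) * ω →
      0 < η - ω / (1 + ω) ∧ 0 < 1 + (1 - κ) * ω) := by
  refine ⟨?_, fun ω h h0 hA => ⟨?_, second_factor_pos_of_cubicEq hs h h0 hA⟩⟩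
  · obtain ⟨ω, h, h0, hA⟩ := exists_fundamental_root hη hκ hs
    refine ⟨ω, ⟨h, h0, hA⟩, fun ω' ⟨h', h0', hA'⟩ => le_antisymm ?_ ?_⟩
    · exact not_lt.mp (not_lt_of_cubicEq hκ hs h h0 h' h0' hA')
    · exact not_lt.mp (not_lt_of_cubicEq hκ hs h' h0' h h0 hA)
  · have h_eq : η - ω / (1 + ω) = (η + (η - 1) * ω) / (1 + ω) := by
      field_simp
      ring
    rw [h_eq]
    positivity
end

section
/- Derivative identities along the root branch: fix η > 0 and κ > 0. The map σ² ↦ ω(σ²) assigning to each σ² > 0 the selected root of the cubic is differentiable on (0,∞), and with ω̄ = 1/(1+ω), δ = (κ/σ²)(η − ωω̄) and Δ_{σ²} = σ² + κωω̄²/(δ(1 + δω̄²)), its derivatives satisfy: ω' = −ω/((1 + δω̄²)Δ_{σ²}), δ' = −δ/Δ_{σ²} (equivalently ω' = ωδ'/(δ(1 + δω̄²))), and (d/dσ²)(ω̄) = −ωω̄²δ'/(δ(1 + δω̄²)). -/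
/-- The noise power `t` recovered from a root `x` of the cubic. -/
noncomputable def noiseOfRoot (η κ x : ℝ) : ℝ :=
  (η - x / (1 + x)) * (1 / x - κ / (1 + x))

/-- For `t, x > 0`, the cubic equation holds exactly when `t` is the noise power recovered
from `x`. -/
theorem cubicEq_iff_noiseOfRoot_eq {η κ t x : ℝ} (ht : 0 < t) (hx : 0 < x) :
    cubicEq η κ t x ↔ noiseOfRoot η κ x = t := by
  have hx1 : 1 + x ≠ 0 := by positivity
  have key : x ^ 3 + (2 * t + η * κ - κ - η + 1) * x ^ 2 / t
      + (1 + η * κ / t - 2 * η / t + 1 / t) * x - η / t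
      = x * (1 + x) ^ 2 / t * (t - noiseOfRoot η κ x) := by
    unfold noiseOfRoot
    field_simp
    ring
  have hpos : x * (1 + x) ^ 2 / t ≠ 0 := by positivity
  rw [cubicEq, key, mul_eq_zero, or_iff_right hpos, sub_eq_zero, eq_comm]

theorem sub_div_one_add_pos {η x : ℝ} (hx : 0 < x) (hq : 0 < η + (η - 1) * x) :
    0 < η - x / (1 + x) := by
  have h : η - x / (1 + x) = (η + (η - 1) * x) / (1 + x) := by
    field_simp
    ring
  rw [h]
  positivity

theorem noiseOfRoot_lt {η κ x y : ℝ} (hκ : 0 < κ) (hx : 0 < x) (hxy : x < y)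
    (hqy : 0 < η + (η - 1) * y) (hy : 0 < noiseOfRoot η κ y) :
    noiseOfRoot η κ y < noiseOfRoot η κ x := by
  have hy0 : 0 < y := hx.trans hxy
  have ha := sub_div_one_add_pos hy0 hqy
  have hb : 0 < 1 / y - κ / (1 + y) := (pos_iff_pos_of_mul_pos hy).mp ha
  have hab : η - y / (1 + y) < η - x / (1 + x) := by
    have : x / (1 + x) < y / (1 + y) := by
      rw [div_lt_div_iff₀ (by positivity) (by positivity)]
      linarith
    linarith
  have hbb : 1 / y - κ / (1 + y) < 1 / x - κ / (1 + x) := by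
    have hfac : ∀ z : ℝ, 0 < z → 1 / z - κ / (1 + z) = 1 / z * (1 - κ * (z / (1 + z))) := by
      intro z hz
      field_simp
    have h1 : 1 / y < 1 / x := one_div_lt_one_div_of_lt hx hxy
    have h2 : 1 - κ * (y / (1 + y)) < 1 - κ * (x / (1 + x)) := by
      have := mul_lt_mul_of_pos_left (show x / (1 + x) < y / (1 + y) by linarith) hκ
      linarith
    rw [hfac y hy0] at hb ⊢
    rw [hfac x hx]
    have h3 : 0 < 1 - κ * (y / (1 + y)) := (pos_iff_pos_of_mul_pos hb).mp (by positivity)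
    exact mul_lt_mul'' h1 h2 (by positivity) h3.le
  exact mul_lt_mul'' hab hbb ha.le hb.le

theorem IsSelRoot.unique {η κ t x y : ℝ} (hκ : 0 < κ) (ht : 0 < t)
    (hx : IsSelRoot η κ t x) (hy : IsSelRoot η κ t y) : x = y := by
  obtain ⟨hcx, hx0, hqx⟩ := hx
  obtain ⟨hcy, hy0, hqy⟩ := hy
  rw [cubicEq_iff_noiseOfRoot_eq ht hx0] at hcx
  rw [cubicEq_iff_noiseOfRoot_eq ht hy0] at hcy
  rcases lt_trichotomy x y with h | h | h
  · have := noiseOfRoot_lt hκ hx0 h hqy (hcy.symm ▸ ht)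
    linarith
  · exact h
  · have := noiseOfRoot_lt hκ hy0 h hqx (hcx.symm ▸ ht)
    linarith

theorem hasStrictDerivAt_noiseOfRoot (η κ : ℝ) {x : ℝ} (hx : 0 < x) :
    HasStrictDerivAt (noiseOfRoot η κ)
      (-(1 / (1 + x)) ^ 2 * (1 / x - κ / (1 + x))
        + (η - x / (1 + x)) * (-(1 / x) ^ 2 + κ * (1 / (1 + x)) ^ 2)) x := by
  have hx1 : 1 + x ≠ 0 := by positivity
  have hid := hasStrictDerivAt_id x
  have hadd : HasStrictDerivAt (fun z : ℝ => 1 + z) 1 x := hid.const_add 1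
  have h1 : HasStrictDerivAt (fun z : ℝ => η - z / (1 + z)) _ x := (hid.div hadd hx1).const_sub η
  have h2 : HasStrictDerivAt (fun z : ℝ => 1 / z - κ / (1 + z)) _ x :=
    ((hasStrictDerivAt_const x (1 : ℝ)).div hid hx.ne').sub
      ((hasStrictDerivAt_const x κ).div hadd hx1)
  refine (h1.mul h2).congr_deriv ?_
  simp only [id]
  field_simp
  ring

/-- Any branch of selected roots is a local left inverse of `noiseOfRoot`, hence differentiable. -/
theorem hasDerivAt_root_branch {η κ s f' : ℝ} (hκ : 0 < κ) {W : ℝ → ℝ}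
    (hW : ∀ t > 0, IsSelRoot η κ t (W t)) (hs : 0 < s)
    (hf : HasStrictDerivAt (noiseOfRoot η κ) f' (W s)) (hf' : f' ≠ 0) :
    HasDerivAt W f'⁻¹ s := by
  obtain ⟨hc, h0, hq⟩ := hW s hs
  have hgs := (cubicEq_iff_noiseOfRoot_eq hs h0).mp hc
  have hcont := hf.hasDerivAt.continuousAt
  have hev : ∀ᶠ x in nhds (W s), W (noiseOfRoot η κ x) = x := by
    have e1 : ∀ᶠ x in nhds (W s), 0 < x := lt_mem_nhds h0
    have e2 : ∀ᶠ x in nhds (W s), 0 < η + (η - 1) * x :=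
      (show Continuous fun x : ℝ => η + (η - 1) * x by fun_prop).continuousAt.eventually
        (lt_mem_nhds hq)
    have e3 : ∀ᶠ x in nhds (W s), 0 < noiseOfRoot η κ x :=
      hcont.eventually (lt_mem_nhds (hgs.symm ▸ hs))
    filter_upwards [e1, e2, e3] with x hx1 hx2 hx3
    exact (hW _ hx3).unique hκ hx3 ⟨(cubicEq_iff_noiseOfRoot_eq hx3 hx1).mpr rfl, hx1, hx2⟩
  have := (hf.to_local_left_inverse hf' hev).hasDerivAt
  rwa [hgs] at this

/-- Derivative identities along the root branch: the map σ² ↦ ω(σ²) is differentiable on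
(0,∞) and, with ω̄ = 1/(1+ω), δ = (κ/σ²)(η − ωω̄), Δ_{σ²} = σ² + κωω̄²/(δ(1 + δω̄²)),
ω' = −ω/((1 + δω̄²)Δ_{σ²}), δ' = −δ/Δ_{σ²} (equivalently ω' = ωδ'/(δ(1 + δω̄²))), and
(ω̄)' = −ωω̄²δ'/(δ(1 + δω̄²)). -/
theorem derivative_identities_along_root_branch
    (η κ : ℝ) (hη : 0 < η) (hκ : 0 < κ)
    (W : ℝ → ℝ) (hW : ∀ t > 0, IsSelRoot η κ t (W t)) :
    ∀ s > 0, ∀ ω ob δ Δ : ℝ,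
      ω = W s → ob = 1 / (1 + ω) → δ = κ / s * (η - ω * ob) →
      Δ = s + κ * ω * ob ^ 2 / (δ * (1 + δ * ob ^ 2)) →
      HasDerivAt W (-ω / ((1 + δ * ob ^ 2) * Δ)) s ∧
      HasDerivAt (deltaFun η κ W) (-δ / Δ) s ∧
      -ω / ((1 + δ * ob ^ 2) * Δ) = ω * (-δ / Δ) / (δ * (1 + δ * ob ^ 2)) ∧
      HasDerivAt (fun t => 1 / (1 + W t)) (-(ω * ob ^ 2 * (-δ / Δ)) / (δ * (1 + δ * ob ^ 2))) s := by
  intro s hs ω ob δ Δ hω hob hδ hΔ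
  obtain ⟨hc, h0, hq⟩ := hW s hs
  have hgs := (cubicEq_iff_noiseOfRoot_eq hs h0).mp hc
  have ha := sub_div_one_add_pos h0 hq
  have hstrict := hasStrictDerivAt_noiseOfRoot η κ h0
  rw [← hω] at h0 hgs ha hstrict
  have hω1 : 1 + ω ≠ 0 := by positivity
  have hob0 : 0 < ob := by rw [hob]; positivity
  have hωob : ω / (1 + ω) = ω * ob := by rw [hob]; ring
  have hb : 0 < 1 / ω - κ / (1 + ω) :=
    (pos_iff_pos_of_mul_pos (show 0 < (η - ω / (1 + ω)) * (1 / ω - κ / (1 + ω)) by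
      rw [← noiseOfRoot, hgs]; exact hs)).mp ha
  unfold noiseOfRoot at hgs
  rw [hωob] at ha
  have hδ0 : 0 < δ := by rw [hδ]; positivity
  have hc0 : 0 < 1 + δ * ob ^ 2 := by positivity
  have hΔ0 : 0 < Δ := by rw [hΔ]; positivity
  have hδb : δ * (1 / ω - κ / (1 + ω)) = κ := by
    rw [hωob] at hgs
    rw [hδ, div_mul_eq_mul_div, div_mul_eq_mul_div, mul_assoc, hgs]
    field_simp
  have hΔmul : δ * (1 + δ * ob ^ 2) * (Δ - s) = κ * ω * ob ^ 2 := by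
    rw [hΔ]
    field_simp
    ring
  have hderiv : -(1 / (1 + ω)) ^ 2 * (1 / ω - κ / (1 + ω))
        + (η - ω / (1 + ω)) * (-(1 / ω) ^ 2 + κ * (1 / (1 + ω)) ^ 2)
      = -((1 + δ * ob ^ 2) * Δ) / ω := by
    rw [← hob]
    have hsq : (1 / ω) ^ 2 - κ * ob ^ 2
        = (1 / ω - κ / (1 + ω) + κ * ob ^ 2) / ω := by
      rw [hob]
      field_simp
      ring
    have hcΔ : (1 + δ * ob ^ 2) * Δ = (1 + δ * ob ^ 2) * s
        + ω * ob ^ 2 * (1 / ω - κ / (1 + ω)) := by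
      apply mul_left_cancel₀ hδ0.ne'
      linear_combination hΔmul - ω * ob ^ 2 * hδb
    have hδs : δ * s = κ * (η - ω / (1 + ω)) := by
      rw [hδ, hωob]
      field_simp
    rw [hcΔ, show -ob ^ 2 * (1 / ω - κ / (1 + ω)) + (η - ω / (1 + ω)) * (-(1 / ω) ^ 2 + κ * ob ^ 2)
      = -ob ^ 2 * (1 / ω - κ / (1 + ω)) - (η - ω / (1 + ω)) * ((1 / ω) ^ 2 - κ * ob ^ 2) by ring,
      hsq, eq_div_iff h0.ne', sub_mul, mul_assoc (η - ω / (1 + ω)), div_mul_cancel₀ _ h0.ne']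
    linear_combination -hgs + ob ^ 2 * hδs
  rw [hderiv] at hstrict
  have hWd : HasDerivAt W (-ω / ((1 + δ * ob ^ 2) * Δ)) s := by
    have hne : -((1 + δ * ob ^ 2) * Δ) / ω ≠ 0 :=
      div_ne_zero (neg_ne_zero.mpr (by positivity)) h0.ne'
    have hstrict' : HasStrictDerivAt (noiseOfRoot η κ) (-((1 + δ * ob ^ 2) * Δ) / ω) (W s) := by
      rwa [← hω]
    refine (hasDerivAt_root_branch hκ hW hs hstrict' hne).congr_deriv ?_
    rw [inv_div, div_neg, neg_div]
  have hW1 : 1 + W s ≠ 0 := hω ▸ hω1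
  have hobd : HasDerivAt (fun t => 1 / (1 + W t))
      (-(ω * ob ^ 2 * (-δ / Δ)) / (δ * (1 + δ * ob ^ 2))) s := by
    refine ((hasDerivAt_const s (1 : ℝ)).div (hWd.const_add 1) hW1).congr_deriv ?_
    rw [← hω, hob]
    field_simp
    ring
  refine ⟨hWd, ?_, by field_simp, hobd⟩
  have hd := ((hasDerivAt_const s κ).div (hasDerivAt_id s) hs.ne').mul
    ((hWd.div (hWd.const_add 1) hW1).const_sub η)
  refine HasDerivAt.congr_deriv (f := deltaFun η κ W) hd ?_
  have hδs : κ / s * (η - ω / (1 + ω)) = δ := by rw [hδ, hωob]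
  simp only [id, Pi.div_apply]
  rw [← hω]
  have hquot : (-ω / ((1 + δ * ob ^ 2) * Δ) * (1 + ω) - ω * (-ω / ((1 + δ * ob ^ 2) * Δ)))
      / (1 + ω) ^ 2 = -ω * ob ^ 2 / ((1 + δ * ob ^ 2) * Δ) := by
    rw [hob]
    field_simp
    ring
  rw [hquot, show (0 * s - κ * 1) / s ^ 2 * (η - ω / (1 + ω)) = -δ / s by
    rw [← hδs]; field_simp; ring]
  field_simp
  linear_combination -hΔmul
end

section
/- Derivative of the asymptotic mutual information: fix η > 0 and κ > 0, and for σ² > 0 let ω be the selected root of the cubic, ω̄ = 1/(1+ω), δ = (κ/σ²)(η − ωω̄), and C̄(σ²) = −log(σ²)/κ − (η − 1/κ)·log(1 − ω/(η(1+ω))) + log(1+ω) − log(ω)/κ − 2ω/(1+ω) + log(η)/κ. Then σ² ↦ C̄(σ²) is differentiable on (0,∞) and d C̄(σ²)/dσ² = δ/κ − η/σ². -/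
/-- The asymptotic per-antenna mutual information C̄(σ²), expressed through the value ω of
the selected root at t = σ². -/
noncomputable def CbarOf (η κ ω t : ℝ) : ℝ :=
  -Real.log t / κ - (η - 1 / κ) * Real.log (1 - ω / (η * (1 + ω)))
    + Real.log (1 + ω) - Real.log ω / κ - 2 * ω / (1 + ω) + Real.log η / κ

open Filter Topology

/-- The open interval containing `ω / (1 + ω)` for the selected root `ω`. -/
def rootInterval (η κ : ℝ) : Set ℝ := {u | 0 < u ∧ u < 1 ∧ u < η ∧ κ * u < 1}

/-- The noise power at which the selected root `ω` satisfies `ω / (1 + ω) = u`. -/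
noncomputable def noiseOf (η κ u : ℝ) : ℝ := (η - u) * (1 - κ * u) * (1 - u) / u

/-- The logarithmic derivative of `noiseOf`. -/
noncomputable def noiseLogDeriv (η κ u : ℝ) : ℝ :=
  -(1 / (η - u) + κ / (1 - κ * u) + 1 / (1 - u) + 1 / u)

theorem noiseOf_strictAntiOn {η κ : ℝ} (hκ : 0 < κ) :
    StrictAntiOn (noiseOf η κ) (rootInterval η κ) := by
  rintro u ⟨hu0, hu1, huη, huκ⟩ v ⟨hv0, hv1, hvη, hvκ⟩ huv
  have h1 : κ * u < κ * v := mul_lt_mul_of_pos_left huv hκ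
  unfold noiseOf
  have h2 : (η - v) * (1 - κ * v) < (η - u) * (1 - κ * u) :=
    mul_lt_mul (by linarith) (by linarith) (by linarith) (by linarith)
  have h3 : (η - v) * (1 - κ * v) * (1 - v) < (η - u) * (1 - κ * u) * (1 - u) :=
    mul_lt_mul h2 (by linarith) (by linarith)
      (mul_nonneg (by linarith) (by linarith))
  have h4 : 0 < (η - v) * (1 - κ * v) * (1 - v) :=
    mul_pos (mul_pos (by linarith) (by linarith)) (by linarith)
  exact div_lt_div₀ h3 huv.le (h4.trans h3).le hu0

theorem noiseOf_hasDerivAt {η κ u : ℝ} (hu : u ∈ rootInterval η κ) :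
    HasDerivAt (noiseOf η κ) (noiseOf η κ u * noiseLogDeriv η κ u) u := by
  obtain ⟨hu0, hu1, huη, huκ⟩ := hu
  have h := ((((hasDerivAt_id u).const_sub η).mul
    (((hasDerivAt_id u).const_mul κ).const_sub 1)).mul
      ((hasDerivAt_id u).const_sub 1)).div (hasDerivAt_id u) hu0.ne'
  refine h.congr_deriv ?_
  have h1 : η - u ≠ 0 := by linarith
  have h2 : 1 - κ * u ≠ 0 := by linarith
  have h3 : 1 - u ≠ 0 := by linarith
  simp only [noiseOf, noiseLogDeriv, id, Pi.mul_apply]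
  field_simp
  ring

theorem noiseLogDeriv_neg {η κ u : ℝ} (hκ : 0 < κ) (hu : u ∈ rootInterval η κ) :
    noiseLogDeriv η κ u < 0 := by
  obtain ⟨hu0, hu1, huη, huκ⟩ := hu
  have h1 : 0 < η - u := by linarith
  have h2 : 0 < 1 - κ * u := by linarith
  have h3 : 0 < 1 - u := by linarith
  exact neg_neg_of_pos (by positivity)

theorem IsSelRoot.mem_rootInterval_and_noiseOf_eq {η κ t ω : ℝ} (ht : 0 < t)
    (h : IsSelRoot η κ t ω) :
    ω / (1 + ω) ∈ rootInterval η κ ∧ noiseOf η κ (ω / (1 + ω)) = t := by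
  obtain ⟨hc, hω, hA⟩ := h
  have h1 : 0 < 1 + ω := by linarith
  have key : t * (ω * (1 + ω) ^ 2) = (η + (η - 1) * ω) * (1 + ω - κ * ω) := by
    unfold cubicEq at hc
    field_simp at hc
    linear_combination hc
  have hB : 0 < 1 + ω - κ * ω := by
    refine pos_of_mul_pos_right ?_ hA.le
    rw [← key]
    positivity
  refine ⟨⟨by positivity, ?_, ?_, ?_⟩, ?_⟩
  · rw [div_lt_one h1]; linarith
  · rw [div_lt_iff₀ h1]; linarith
  · rw [← mul_div_assoc, div_lt_one h1]; linarith
  · unfold noiseOf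
    field_simp
    linear_combination -key

/-- A right inverse of `noiseOf` on the positive reals with values in `rootInterval` is
continuous. -/
theorem continuousAt_of_noiseOf_eq {η κ : ℝ} (hκ : 0 < κ) {u : ℝ → ℝ}
    (hu : ∀ t > 0, u t ∈ rootInterval η κ ∧ noiseOf η κ (u t) = t) {s : ℝ} (hs : 0 < s) :
    ContinuousAt u s := by
  have anti := noiseOf_strictAntiOn (η := η) hκ
  obtain ⟨hsI, hsF⟩ := hu s hs
  have hpos : ∀ᶠ t in 𝓝 s, 0 < t := lt_mem_nhds hs
  refine tendsto_order.2 ⟨fun a ha => ?_, fun b hb => ?_⟩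
  · by_cases ha0 : 0 < a
    · have haI : a ∈ rootInterval η κ :=
        ⟨ha0, ha.trans hsI.2.1, ha.trans hsI.2.2.1,
          (mul_lt_mul_of_pos_left ha hκ).trans hsI.2.2.2⟩
      have hlt : s < noiseOf η κ a := hsF ▸ anti haI hsI ha
      filter_upwards [hpos, gt_mem_nhds hlt] with t ht hta
      obtain ⟨htI, htF⟩ := hu t ht
      exact (anti.lt_iff_gt htI haI).1 (by rwa [htF])
    · filter_upwards [hpos] with t ht
      exact (not_lt.1 ha0).trans_lt (hu t ht).1.1
  · by_cases hbI : b ∈ rootInterval η κ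
    · have hlt : noiseOf η κ b < s := hsF ▸ anti hsI hbI hb
      filter_upwards [hpos, lt_mem_nhds hlt] with t ht htb
      obtain ⟨htI, htF⟩ := hu t ht
      exact (anti.lt_iff_gt hbI htI).1 (by rwa [htF])
    · filter_upwards [hpos] with t ht
      obtain ⟨h0, h1, h2, h3⟩ := (hu t ht).1
      by_contra! hle
      exact hbI ⟨hsI.1.trans hb, hle.trans_lt h1, hle.trans_lt h2,
        (mul_le_mul_of_nonneg_left hle hκ.le).trans_lt h3⟩

/-- `CbarOf` in terms of `u = ω / (1 + ω)`. -/
theorem CbarOf_eq {η κ ω t : ℝ} (hω : 0 < ω) :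
    CbarOf η κ ω t =
      -Real.log t / κ - (η - 1 / κ) * Real.log (1 - ω / (1 + ω) / η)
        - (1 - 1 / κ) * Real.log (1 - ω / (1 + ω)) - Real.log (ω / (1 + ω)) / κ
        - 2 * (ω / (1 + ω)) + Real.log η / κ := by
  have h1 : 0 < 1 + ω := by linarith
  have h2 : 1 - ω / (1 + ω) = (1 + ω)⁻¹ := by field_simp; ring
  rw [CbarOf, h2, Real.log_inv, Real.log_div hω.ne' h1.ne', div_div, mul_comm (1 + ω) η]
  ring

/-- Derivative of the asymptotic mutual information: σ² ↦ C̄(σ²) is differentiable on (0,∞)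
with derivative δ/κ − η/σ², where δ = (κ/σ²)(η − ω/(1+ω)). -/
theorem derivative_of_asymptotic_MI
    (η κ : ℝ) (hη : 0 < η) (hκ : 0 < κ)
    (W : ℝ → ℝ) (hW : ∀ t > 0, IsSelRoot η κ t (W t)) :
    ∀ s > 0,
      HasDerivAt (fun t => CbarOf η κ (W t) t)
        ((κ / s * (η - W s / (1 + W s))) / κ - η / s) s := by
  intro s hs
  have hu t (ht : t > 0) := (hW t ht).mem_rootInterval_and_noiseOf_eq ht
  obtain ⟨hsI, hsF⟩ := hu s hs
  have hL := noiseLogDeriv_neg hκ hsI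
  have hpos : ∀ᶠ t in 𝓝 s, 0 < t := lt_mem_nhds hs
  have hd := noiseOf_hasDerivAt hsI
  rw [hsF] at hd
  have hud : HasDerivAt (fun t => W t / (1 + W t)) _ s :=
    hd.of_local_left_inverse (continuousAt_of_noiseOf_eq hκ hu hs)
      (mul_ne_zero hs.ne' hL.ne) (by filter_upwards [hpos] with t ht using (hu t ht).2)
  have hC : (fun t => CbarOf η κ (W t) t) =ᶠ[𝓝 s] fun t =>
      -Real.log t / κ - (η - 1 / κ) * Real.log (1 - W t / (1 + W t) / η)
        - (1 - 1 / κ) * Real.log (1 - W t / (1 + W t)) - Real.log (W t / (1 + W t)) / κ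
        - 2 * (W t / (1 + W t)) + Real.log η / κ := by
    filter_upwards [hpos] with t ht using CbarOf_eq (hW t ht).2.1
  refine HasDerivAt.congr_of_eventuallyEq ?_ hC
  obtain ⟨h0, h1, h2, h3⟩ := hsI
  generalize hv : W s / (1 + W s) = v at *
  have h1' : 1 - v ≠ 0 := by linarith
  have h2' : η - v ≠ 0 := by linarith
  have h3' : 1 - κ * v ≠ 0 := by linarith
  have hη' : 1 - v / η ≠ 0 := by
    rw [ne_eq, sub_eq_zero, eq_comm, div_eq_one_iff_eq hη.ne']
    exact h2.ne
  have hder := (((((((Real.hasDerivAt_log hs.ne').neg.div_const κ).sub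
    ((((hud.div_const η).const_sub 1).log (by rwa [hv])).const_mul (η - 1 / κ))).sub
    (((hud.const_sub 1).log (by rwa [hv])).const_mul (1 - 1 / κ))).sub
    ((hud.log (by rw [hv]; exact h0.ne')).div_const κ)).sub
    (hud.const_mul 2)).add_const (Real.log η / κ))
  refine hder.congr_deriv ?_
  rw [hv]
  have key : (1 / κ - v) * noiseLogDeriv η κ v
      = (η - 1 / κ) / (η - v) + (1 - 1 / κ) / (1 - v) - 1 / (κ * v) - 2 := by
    unfold noiseLogDeriv
    field_simp
    ring
  have hηv : 1 - v / η = (η - v) / η := by field_simp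
  rw [hηv]
  generalize noiseLogDeriv η κ v = L at *
  have hL' := hL.ne
  trans -(1 / (κ * s)) + ((η - 1 / κ) / (η - v) + (1 - 1 / κ) / (1 - v) - 1 / (κ * v) - 2)
    / (s * L)
  · field_simp
    ring
  · rw [← key]
    field_simp
    ring
end

section
/- Alternative closed form of the asymptotic mutual information: fix η, κ, σ² > 0, let ω be the selected root of the cubic, ω̄ = 1/(1+ω), δ = (κ/σ²)(η − ωω̄). Then −log(σ²)/κ − (η − 1/κ)·log(1 − ω/(η(1+ω))) + log(1+ω) − log(ω)/κ − 2ω/(1+ω) + log(η)/κ = η·log(1 + κωω̄/(σ²δ)) + (1/κ)·log(1 + δω̄) + log(1+ω) − 2ωω̄. -/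
/-- The cubic equation, cleared of denominators and factored. -/
lemma cubicEq.factored {η κ t ω : ℝ} (ht : t ≠ 0) (h : cubicEq η κ t ω) :
    t * ω * (1 + ω) ^ 2 = (η + (η - 1) * ω) * (1 + ω - κ * ω) := by
  unfold cubicEq at h
  field_simp at h
  linear_combination h

/-- Alternative closed form of the asymptotic mutual information: with ω the selected root,
ω̄ = 1/(1+ω), δ = (κ/σ²)(η − ωω̄),
−log(σ²)/κ − (η − 1/κ)·log(1 − ω/(η(1+ω))) + log(1+ω) − log(ω)/κ − 2ω/(1+ω) + log(η)/κ
  = η·log(1 + κωω̄/(σ²δ)) + (1/κ)·log(1 + δω̄) + log(1+ω) − 2ωω̄. -/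
theorem alternative_closed_form_EMI
    (η κ s : ℝ) (hη : 0 < η) (hκ : 0 < κ) (hs : 0 < s)
    (ω : ℝ) (hω : IsSelRoot η κ s ω)
    (ob δ : ℝ) (hob : ob = 1 / (1 + ω)) (hδ : δ = κ / s * (η - ω * ob)) :
    -Real.log s / κ - (η - 1 / κ) * Real.log (1 - ω / (η * (1 + ω)))
      + Real.log (1 + ω) - Real.log ω / κ - 2 * ω / (1 + ω) + Real.log η / κ
    = η * Real.log (1 + κ * ω * ob / (s * δ)) + (1 / κ) * Real.log (1 + δ * ob)
      + Real.log (1 + ω) - 2 * ω * ob := by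
  obtain ⟨hcubic, hω0, hsel⟩ := hω
  have hfac := hcubic.factored hs.ne'
  have h1 : 0 < 1 + ω := by linarith
  have hA : 1 - ω / (η * (1 + ω)) = (η + (η - 1) * ω) / (η * (1 + ω)) := by
    field_simp
    ring
  have hδ' : δ = κ * (η + (η - 1) * ω) / (s * (1 + ω)) := by
    rw [hδ, hob]
    field_simp
    ring
  have hB : 1 + κ * ω * ob / (s * δ) = (1 - ω / (η * (1 + ω)))⁻¹ := by
    rw [hA, hδ', hob, inv_div]
    have hne := hsel.ne'
    generalize hy : η + (η - 1) * ω = y at *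
    field_simp
    linear_combination -hy
  have hC : 1 + δ * ob = η * (1 - ω / (η * (1 + ω))) / (s * ω) := by
    rw [hA, hδ', hob]
    field_simp
    linear_combination hfac
  have hApos : 0 < 1 - ω / (η * (1 + ω)) := by
    rw [hA]
    positivity
  rw [hB, hC, Real.log_inv, Real.log_div (by positivity) (by positivity),
    Real.log_mul hη.ne' hApos.ne', Real.log_mul hs.ne' hω0.ne', hob]
  ring
end

section
/- Simplifications for equal numbers of antennas (η = 1): fix κ > 0 and σ² > 0 and suppose η = 1, so that ω is the positive root of ω³ + 2ω² + (1 + κ/σ² − 1/σ²)ω − 1/σ² = 0 with 1 + (1−κ)ω > 0. Then δ = κω̄/σ², Δ_{σ²} = σ²(1 + 2σ²ω³ + 2σ²ω²)/(1 + σ²ω²(1+ω)), and ω²(1+δω̄)/(1+δω̄²) = ω²(σ²(1+ω)² + ω + 1 + κ)/(σ²(1+ω)² + (1−κ)ω + 1 + κ). -/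
/-- Simplifications for equal numbers of antennas (η = 1): if ω is the positive root of
ω³ + 2ω² + (1 + κ/σ² − 1/σ²)ω − 1/σ² = 0 with ω > 0 and 1 + (1−κ)ω > 0, then, with
ω̄ = 1/(1+ω), δ = (κ/σ²)(1 − ωω̄) and Δ_{σ²} = σ² + κωω̄²/(δ(1 + δω̄²)):
δ = κω̄/σ², Δ_{σ²} = σ²(1 + 2σ²ω³ + 2σ²ω²)/(1 + σ²ω²(1+ω)), and
ω²(1+δω̄)/(1+δω̄²) = ω²(σ²(1+ω)² + ω + 1 + κ)/(σ²(1+ω)² + (1−κ)ω + 1 + κ). -/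
theorem equal_antennas_simplifications
    (κ s : ℝ) (hκ : 0 < κ) (hs : 0 < s) (ω : ℝ)
    (hcubic : ω ^ 3 + 2 * ω ^ 2 + (1 + κ / s - 1 / s) * ω - 1 / s = 0)
    (hωpos : 0 < ω) (hsel : 0 < 1 + (1 - κ) * ω)
    (ob δ Δ : ℝ) (hob : ob = 1 / (1 + ω)) (hδ : δ = κ / s * (1 - ω * ob))
    (hΔ : Δ = s + κ * ω * ob ^ 2 / (δ * (1 + δ * ob ^ 2))) :
    δ = κ * ob / s ∧
    Δ = s * (1 + 2 * s * ω ^ 3 + 2 * s * ω ^ 2) / (1 + s * ω ^ 2 * (1 + ω)) ∧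
    ω ^ 2 * (1 + δ * ob) / (1 + δ * ob ^ 2)
      = ω ^ 2 * (s * (1 + ω) ^ 2 + ω + 1 + κ) / (s * (1 + ω) ^ 2 + (1 - κ) * ω + 1 + κ) := by
  have hu : 0 < 1 + ω := by linarith
  have hpoly : s * ω * (1 + ω) ^ 2 + κ * ω - (1 + ω) = 0 := by
    field_simp at hcubic
    linarith
  have hδ' : δ = κ * ob / s := by
    rw [hδ, hob]
    field_simp
    ring
  have hdob : 1 + δ * ob = (s * (1 + ω) ^ 2 + κ) / (s * (1 + ω) ^ 2) := by
    rw [hδ', hob]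
    field_simp
  have hdob2 : 1 + δ * ob ^ 2 = (s * (1 + ω) ^ 3 + κ) / (s * (1 + ω) ^ 3) := by
    rw [hδ', hob]
    field_simp
  have hE : 0 < s * (1 + ω) ^ 3 + κ := by positivity
  have hD : 0 < 1 + s * ω ^ 2 * (1 + ω) := by positivity
  have hF : 0 < s * (1 + ω) ^ 2 + (1 - κ) * ω + 1 + κ := by
    have : 0 < s * (1 + ω) ^ 2 := by positivity
    linarith
  refine ⟨hδ', ?_, ?_⟩
  · have hfrac : κ * ω * ob ^ 2 / (δ * (1 + δ * ob ^ 2))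
        = s ^ 2 * ω * (1 + ω) ^ 2 / (s * (1 + ω) ^ 3 + κ) := by
      rw [hdob2, hδ', hob]
      field_simp
    rw [hΔ, hfrac, eq_div_iff hD.ne', add_mul, div_mul_eq_mul_div, ← eq_sub_iff_add_eq',
      div_eq_iff hE.ne']
    linear_combination (-s ^ 2 * ω * (1 + ω)) * hpoly
  · have hratio : ω ^ 2 * (1 + δ * ob) / (1 + δ * ob ^ 2)
        = ω ^ 2 * ((s * (1 + ω) ^ 2 + κ) * (1 + ω)) / (s * (1 + ω) ^ 3 + κ) := by
      rw [hdob, hdob2]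
      field_simp
    rw [hratio, div_eq_div_iff hE.ne' hF.ne']
    linear_combination (-ω ^ 3 * κ) * hpoly
end

section
/- Gap between the Gaussian bounds: for all real numbers r < 0 and 0 < V₋ < V₊, one has 0 < Φ(r/√V₊) − Φ(r/√V₋) ≤ −r·(V₊ − V₋)/(√(2π V₊ V₋)·(√V₊ + √V₋)), where Φ is the cumulative distribution function of the standard normal distribution. -/
/-- The cumulative distribution function of the standard normal distribution. -/
noncomputable def stdNormalCDF (x : ℝ) : ℝ :=
  ∫ t in Set.Iic x, Real.exp (-t ^ 2 / 2) / Real.sqrt (2 * Real.pi)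

open MeasureTheory in
lemma integrable_stdNormalDensity :
    Integrable (fun t : ℝ => Real.exp (-t ^ 2 / 2) / Real.sqrt (2 * Real.pi)) := by
  have h := (integrable_exp_neg_mul_sq (b := 1 / 2) (by norm_num)).div_const
    (Real.sqrt (2 * Real.pi))
  refine h.congr (.of_forall fun t => ?_)
  simp only
  congr 2
  ring

open MeasureTheory in
lemma stdNormalCDF_sub (x y : ℝ) :
    stdNormalCDF y - stdNormalCDF x =
      ∫ t in x..y, Real.exp (-t ^ 2 / 2) / Real.sqrt (2 * Real.pi) :=
  intervalIntegral.integral_Iic_sub_Iic integrable_stdNormalDensity.integrableOn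
    integrable_stdNormalDensity.integrableOn

lemma stdNormalCDF_strictMono : StrictMono stdNormalCDF := by
  intro x y hxy
  rw [← sub_pos, stdNormalCDF_sub]
  exact intervalIntegral.intervalIntegral_pos_of_pos
    integrable_stdNormalDensity.intervalIntegrable (fun t => by positivity) hxy

lemma stdNormalCDF_sub_le {x y : ℝ} (hxy : x ≤ y) :
    stdNormalCDF y - stdNormalCDF x ≤ (y - x) / Real.sqrt (2 * Real.pi) := by
  rw [stdNormalCDF_sub]
  calc ∫ t in x..y, Real.exp (-t ^ 2 / 2) / Real.sqrt (2 * Real.pi)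
      ≤ ∫ _ in x..y, 1 / Real.sqrt (2 * Real.pi) := by
        refine intervalIntegral.integral_mono_on hxy
          integrable_stdNormalDensity.intervalIntegrable intervalIntegrable_const fun t _ => ?_
        gcongr
        exact Real.exp_le_one_iff.mpr (by nlinarith [sq_nonneg t])
    _ = (y - x) / Real.sqrt (2 * Real.pi) := by
        rw [intervalIntegral.integral_const, smul_eq_mul, mul_one_div]

/-- Gap between the Gaussian bounds: for all real numbers r < 0 and 0 < V₋ < V₊,
0 < Φ(r/√V₊) − Φ(r/√V₋) ≤ −r·(V₊ − V₋)/(√(2π V₊ V₋)·(√V₊ + √V₋)). -/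
theorem gaussian_bounds_gap
    (r Vm Vp : ℝ) (hr : r < 0) (hVm : 0 < Vm) (hVmp : Vm < Vp) :
    0 < stdNormalCDF (r / Real.sqrt Vp) - stdNormalCDF (r / Real.sqrt Vm) ∧
    stdNormalCDF (r / Real.sqrt Vp) - stdNormalCDF (r / Real.sqrt Vm)
      ≤ -r * (Vp - Vm) / (Real.sqrt (2 * Real.pi * Vp * Vm) * (Real.sqrt Vp + Real.sqrt Vm)) := by
  have hVp : 0 < Vp := hVm.trans hVmp
  have hb : 0 < Real.sqrt Vm := Real.sqrt_pos.mpr hVm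
  have hba : Real.sqrt Vm < Real.sqrt Vp := Real.sqrt_lt_sqrt hVm.le hVmp
  have ha : 0 < Real.sqrt Vp := hb.trans hba
  have hlt : r / Real.sqrt Vm < r / Real.sqrt Vp := by
    rw [div_lt_div_iff₀ hb ha]
    exact mul_lt_mul_of_neg_left hba hr
  refine ⟨sub_pos.mpr (stdNormalCDF_strictMono hlt),
    (stdNormalCDF_sub_le hlt.le).trans_eq ?_⟩
  have hpi : 0 < Real.sqrt (2 * Real.pi) := by positivity
  have hVa := Real.sq_sqrt hVp.le
  have hVb := Real.sq_sqrt hVm.le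
  rw [Real.sqrt_mul (by positivity) Vm, Real.sqrt_mul (by positivity) Vp]
  generalize Real.sqrt Vp = a at *
  generalize Real.sqrt Vm = b at *
  generalize Real.sqrt (2 * Real.pi) = c at *
  subst hVa hVb
  field_simp
  ring
end

section
/- High-SNR asymptotics of the fundamental root: fix η > 0 and κ > 0, and for σ² > 0 let ω(σ²) be the selected root of the cubic and δ(σ²) = (κ/σ²)(η − ω/(1+ω)). As σ² ↓ 0: (i) if η > 1 and κ < 1, then σ²·ω(σ²) → (η−1)(1−κ) and σ²·δ(σ²) → κ(η−1); (ii) if η < 1 and ηκ < 1, then ω(σ²) → η/(1−η) and δ(σ²) → ηκ/((1−η)(1−ηκ)); (iii) if (κ > 1 and η > 1) or (ηκ > 1 and η < 1), then ω(σ²) → 1/(κ−1) and σ²·δ(σ²) → ηκ − 1. -/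
open Filter
open scoped Topology

/-- The cubic rewritten in terms of `u = 1 / (1 + ω)`, together with the sign information
carried by the selected root. -/
theorem IsSelRoot.inv_one_add {η κ t ω : ℝ} (ht : 0 < t) (h : IsSelRoot η κ t ω) :
    0 < 1 / (1 + ω) ∧ 1 / (1 + ω) < 1 ∧ 0 < η - 1 + 1 / (1 + ω) ∧
      t * ω = (η - 1 + 1 / (1 + ω)) * (1 - κ + κ * (1 / (1 + ω))) := by
  obtain ⟨hc, hω, hA⟩ := h
  have h1 : 0 < 1 + ω := by linarith
  refine ⟨by positivity, (div_lt_one h1).2 (by linarith), ?_, ?_⟩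
  · have : η - 1 + 1 / (1 + ω) = (η + (η - 1) * ω) / (1 + ω) := by field_simp; ring
    rw [this]
    positivity
  · have hc' : t * ω * (1 + ω) ^ 2 = (η + (η - 1) * ω) * (1 + (1 - κ) * ω) := by
      unfold cubicEq at hc
      field_simp at hc
      linear_combination hc
    have h2 : (η - 1 + 1 / (1 + ω)) * (1 - κ + κ * (1 / (1 + ω)))
        = (η + (η - 1) * ω) * (1 + (1 - κ) * ω) / (1 + ω) ^ 2 := by
      field_simp; ring
    rw [h2, ← hc']
    field_simp

/-- A function within `C * t` of `c` for all `t > 0` tends to `c` as `t ↓ 0`. -/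
theorem tendsto_nhdsGT_zero_of_le_of_le_add {f : ℝ → ℝ} {c C : ℝ}
    (h : ∀ t > 0, c ≤ f t ∧ f t ≤ c + C * t) : Tendsto f (𝓝[>] (0 : ℝ)) (𝓝 c) := by
  have hlim : Tendsto (fun t : ℝ => c + C * t) (𝓝[>] (0 : ℝ)) (𝓝 c) := by
    have : Continuous fun t : ℝ => c + C * t := by fun_prop
    simpa using (this.tendsto 0).mono_left nhdsWithin_le_nhds
  refine tendsto_of_tendsto_of_tendsto_of_le_of_le' tendsto_const_nhds hlim ?_ ?_
  · filter_upwards [self_mem_nhdsWithin] with t ht using (h t ht).1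
  · filter_upwards [self_mem_nhdsWithin] with t ht using (h t ht).2

/-- `W` converges as soon as `1 / (1 + W)` converges to a nonzero limit. -/
theorem tendsto_of_tendsto_obarFun {W : ℝ → ℝ} {l : Filter ℝ} {c : ℝ} (hc : c ≠ 0)
    (h : Tendsto (obarFun W) l (𝓝 c)) : Tendsto W l (𝓝 (1 / c - 1)) := by
  have := (h.inv₀ hc).sub_const 1
  simpa [obarFun] using this

/-- High-SNR asymptotics of the fundamental root: with ω(σ²) the selected root and
δ(σ²) = (κ/σ²)(η − ω/(1+ω)), as σ² ↓ 0:
(i) if η > 1 and κ < 1, then σ²·ω(σ²) → (η−1)(1−κ) and σ²·δ(σ²) → κ(η−1);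
(ii) if η < 1 and ηκ < 1, then ω(σ²) → η/(1−η) and δ(σ²) → ηκ/((1−η)(1−ηκ));
(iii) if (κ > 1 and η > 1) or (ηκ > 1 and η < 1), then ω(σ²) → 1/(κ−1) and
σ²·δ(σ²) → ηκ − 1. -/
theorem high_SNR_asymptotics_of_root
    (η κ : ℝ) (hη : 0 < η) (hκ : 0 < κ)
    (W : ℝ → ℝ) (hW : ∀ t > 0, IsSelRoot η κ t (W t)) :
    ((1 < η ∧ κ < 1) →
      Tendsto (fun t => t * W t) (𝓝[>] (0 : ℝ)) (𝓝 ((η - 1) * (1 - κ))) ∧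
      Tendsto (fun t => t * deltaFun η κ W t) (𝓝[>] (0 : ℝ)) (𝓝 (κ * (η - 1)))) ∧
    ((η < 1 ∧ η * κ < 1) →
      Tendsto W (𝓝[>] (0 : ℝ)) (𝓝 (η / (1 - η))) ∧
      Tendsto (deltaFun η κ W) (𝓝[>] (0 : ℝ)) (𝓝 (η * κ / ((1 - η) * (1 - η * κ))))) ∧
    (((1 < κ ∧ 1 < η) ∨ (1 < η * κ ∧ η < 1)) →
      Tendsto W (𝓝[>] (0 : ℝ)) (𝓝 (1 / (κ - 1))) ∧
      Tendsto (fun t => t * deltaFun η κ W t) (𝓝[>] (0 : ℝ)) (𝓝 (η * κ - 1))) := by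
  have key := fun t (ht : 0 < t) => (hW t ht).inv_one_add ht
  have hω : ∀ t > 0, t * W t * obarFun W t = t * (1 - obarFun W t) := by
    intro t ht
    have : 0 < 1 + W t := by linarith [(hW t ht).2.1]
    unfold obarFun
    field_simp
    ring
  have hδ : ∀ t > 0, t * deltaFun η κ W t = κ * (η - 1 + obarFun W t) := by
    intro t ht
    have : 0 < 1 + W t := by linarith [(hW t ht).2.1]
    unfold obarFun deltaFun
    field_simp
    ring
  simp only [← obarFun.eq_def] at key
  have hcubic : ∀ t > 0, obarFun W t * (η - 1 + obarFun W t) * (1 - κ + κ * obarFun W t)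
      = t * (1 - obarFun W t) := by
    intro t ht
    rw [← hω t ht, (key t ht).2.2.2]
    ring
  have hfac : ∀ t > 0, 0 < 1 - κ + κ * obarFun W t := by
    intro t ht
    obtain ⟨h0, h1, hA, -⟩ := key t ht
    have : 0 < obarFun W t * (η - 1 + obarFun W t) * (1 - κ + κ * obarFun W t) := by
      rw [hcubic t ht]
      exact mul_pos ht (by linarith)
    exact (pos_iff_pos_of_mul_pos this).1 (mul_pos h0 hA)
  have hδlim : ∀ c, Tendsto (obarFun W) (𝓝[>] (0 : ℝ)) (𝓝 c) →
      Tendsto (fun t => t * deltaFun η κ W t) (𝓝[>] (0 : ℝ)) (𝓝 (κ * (η - 1 + c))) := by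
    intro c hc
    refine ((hc.const_add (η - 1)).const_mul κ).congr' ?_
    filter_upwards [self_mem_nhdsWithin] with t ht using (hδ t ht).symm
  refine ⟨?_, ?_, ?_⟩
  · rintro ⟨h1, h2⟩
    have hab : 0 < (η - 1) * (1 - κ) := mul_pos (by linarith) (by linarith)
    have hU : Tendsto (obarFun W) (𝓝[>] (0 : ℝ)) (𝓝 0) := by
      refine tendsto_nhdsGT_zero_of_le_of_le_add (C := 1 / ((η - 1) * (1 - κ))) fun t ht => ?_
      obtain ⟨h0, hlt, hA, -⟩ := key t ht
      refine ⟨h0.le, ?_⟩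
      rw [zero_add, one_div_mul_eq_div, le_div_iff₀ hab]
      have hle : (η - 1) * (1 - κ) ≤ (η - 1 + obarFun W t) * (1 - κ + κ * obarFun W t) :=
        mul_le_mul (by linarith) (by nlinarith) (by linarith) hA.le
      have := mul_le_mul_of_nonneg_left hle h0.le
      nlinarith [hcubic t ht, mul_pos ht h0]
    refine ⟨?_, by simpa using hδlim 0 hU⟩
    have := (hU.const_add (η - 1)).mul ((hU.const_mul κ).const_add (1 - κ))
    simp only [mul_zero, add_zero] at this
    refine this.congr' ?_
    filter_upwards [self_mem_nhdsWithin] with t ht using (key t ht).2.2.2.symm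
  · rintro ⟨h1, h2⟩
    have ha : 0 < 1 - η := by linarith
    have hb : 0 < 1 - η * κ := by linarith
    have hab := mul_pos ha hb
    have hU : Tendsto (obarFun W) (𝓝[>] (0 : ℝ)) (𝓝 (1 - η)) := by
      refine tendsto_nhdsGT_zero_of_le_of_le_add
        (C := 1 / ((1 - η) * (1 - η * κ))) fun t ht => ?_
      obtain ⟨h0, hlt, hA, -⟩ := key t ht
      refine ⟨by linarith, ?_⟩
      rw [← sub_le_iff_le_add', one_div_mul_eq_div, le_div_iff₀ hab]
      have hle : (1 - η) * (1 - η * κ) ≤ obarFun W t * (1 - κ + κ * obarFun W t) :=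
        mul_le_mul (by linarith) (by nlinarith) hb.le h0.le
      have := mul_le_mul_of_nonneg_left hle hA.le
      nlinarith [hcubic t ht, mul_pos ht h0]
    constructor
    · convert tendsto_of_tendsto_obarFun ha.ne' hU using 2
      field_simp
      ring
    · have hden : (1 - η) * (1 - κ + κ * (1 - η)) ≠ 0 := by
        convert hab.ne' using 1
        ring
      have := ((hU.const_sub 1).const_mul κ).div
        (hU.mul ((hU.const_mul κ).const_add (1 - κ))) hden
      have hlim : κ * (1 - (1 - η)) / ((1 - η) * (1 - κ + κ * (1 - η)))
          = η * κ / ((1 - η) * (1 - η * κ)) := by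
        congr 1 <;> ring
      rw [hlim] at this
      refine this.congr' ?_
      filter_upwards [self_mem_nhdsWithin] with t ht
      have ht : 0 < t := ht
      have hpos := mul_pos (key t ht).1 (hfac t ht)
      simp only [Pi.div_apply]
      rw [div_eq_iff hpos.ne']
      apply mul_left_cancel₀ ht.ne'
      linear_combination (-κ) * hcubic t ht
        - obarFun W t * (1 - κ + κ * obarFun W t) * hδ t ht
  · intro h
    have hκ1 : 1 < κ := by rcases h with h | h <;> nlinarith
    have hηκ : 1 < η * κ := by rcases h with h | h <;> nlinarith
    have hp : 0 < 1 - 1 / κ := sub_pos.2 ((div_lt_one hκ).2 hκ1)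
    have hq : 0 < η - 1 / κ := sub_pos.2 ((div_lt_iff₀ hκ).2 hηκ)
    have hpq : 0 < (1 - 1 / κ) * (η - 1 / κ) * κ := by positivity
    have hU : Tendsto (obarFun W) (𝓝[>] (0 : ℝ)) (𝓝 (1 - 1 / κ)) := by
      refine tendsto_nhdsGT_zero_of_le_of_le_add
        (C := 1 / ((1 - 1 / κ) * (η - 1 / κ) * κ)) fun t ht => ?_
      obtain ⟨h0, hlt, hA, -⟩ := key t ht
      have hfac_eq : 1 - κ + κ * obarFun W t = κ * (obarFun W t - (1 - 1 / κ)) := by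
        field_simp
        ring
      have hge : 0 < obarFun W t - (1 - 1 / κ) :=
        (pos_iff_pos_of_mul_pos (hfac_eq ▸ hfac t ht)).1 hκ
      refine ⟨by linarith, ?_⟩
      rw [← sub_le_iff_le_add', one_div_mul_eq_div, le_div_iff₀ hpq]
      have hle : (1 - 1 / κ) * (η - 1 / κ) ≤ obarFun W t * (η - 1 + obarFun W t) :=
        mul_le_mul (by linarith) (by linarith) hq.le h0.le
      have := mul_le_mul_of_nonneg_left hle (hfac t ht).le
      rw [hfac_eq] at this
      have hc := hcubic t ht
      rw [hfac_eq] at hc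
      linarith [mul_pos ht h0]
    have hκ1' : κ - 1 ≠ 0 := by linarith
    constructor
    · convert tendsto_of_tendsto_obarFun hp.ne' hU using 2
      have : 1 - 1 / κ = (κ - 1) / κ := by field_simp
      rw [this]
      field_simp
      ring
    · convert hδlim _ hU using 2
      field_simp
      ring
end
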